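/- Let G be a dense, K_4^3 ∪ e-free 3-graph with λ(G) > √3/18. Then G is K_5^3-free, i.e. no 5-element subset of V(G) has all ten of its triples as edges of G. -/

import Mathlib

open Finset

/-- An `r`-uniform hypergraph (r-graph) with vertices drawn from `ℕ`. -/
structure HyperGraph (r : ℕ) where
  verts : Finset ℕ
  edges : Finset (Finset ℕ)
  edges_sub : ∀ e ∈ edges, e ⊆ verts
  card_eq : ∀ e ∈ edges, e.card = r

/-- A 3-uniform hypergraph (3-graph). -/
abbrev ThreeGraph := HyperGraph 3

/-- A feasible weight vector on `G`: nonnegative weights on the vertices summing to 1. -/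
def HyperGraph.IsFeasible {r : ℕ} (G : HyperGraph r) (w : ℕ → ℝ) : Prop :=
  (∀ v ∈ G.verts, 0 ≤ w v) ∧ ∑ v ∈ G.verts, w v = 1

/-- The Lagrangian function `λ(G, w) = Σ_{e ∈ E(G)} Π_{v ∈ e} w v`. -/
noncomputable def HyperGraph.lagFun {r : ℕ} (G : HyperGraph r) (w : ℕ → ℝ) : ℝ :=
  ∑ e ∈ G.edges, ∏ v ∈ e, w v

/-- The Lagrangian `λ(G)`: the maximum of `λ(G, w)` over feasible weight vectors. -/
noncomputable def HyperGraph.lag {r : ℕ} (G : HyperGraph r) : ℝ :=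
  sSup {x : ℝ | ∃ w, G.IsFeasible w ∧ G.lagFun w = x}

/-- `G` contains a copy of `F`: an injection of the vertices of `F` into those of `G`
mapping every edge of `F` to an edge of `G`. -/
def HyperGraph.ContainsCopy {r : ℕ} (G F : HyperGraph r) : Prop :=
  ∃ f : ℕ → ℕ, Set.InjOn f ↑F.verts ∧ (∀ v ∈ F.verts, f v ∈ G.verts) ∧
    ∀ e ∈ F.edges, e.image f ∈ G.edges

/-- `G` is `F`-free. -/
def HyperGraph.Free {r : ℕ} (G F : HyperGraph r) : Prop := ¬ G.ContainsCopy F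

/-- `H` is a subgraph of `G`. -/
def HyperGraph.IsSubgraph {r : ℕ} (H G : HyperGraph r) : Prop :=
  H.verts ⊆ G.verts ∧ H.edges ⊆ G.edges

/-- `G` is dense: every proper subgraph has strictly smaller Lagrangian. -/
def HyperGraph.LagDense {r : ℕ} (G : HyperGraph r) : Prop :=
  ∀ H : HyperGraph r, H.IsSubgraph G → (H.verts ≠ G.verts ∨ H.edges ≠ G.edges) →
    H.lag < G.lag

/-- The Lagrangian density `π_λ(F) = sup { r! · λ(G) : G is F-free }`. -/
noncomputable def lagDensity {r : ℕ} (F : HyperGraph r) : ℝ :=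
  sSup {x : ℝ | ∃ G : HyperGraph r, G.Free F ∧ x = (Nat.factorial r : ℝ) * G.lag}

/-- An optimum weight vector for `G`. -/
def HyperGraph.IsOptimal {r : ℕ} (G : HyperGraph r) (w : ℕ → ℝ) : Prop :=
  G.IsFeasible w ∧ G.lagFun w = G.lag

/-- `K_4^3 ∪ e`: the disjoint union of the complete 3-graph on `{1,2,3,4}`
and the single edge `{5,6,7}`. -/
def K43e : ThreeGraph where
  verts := {1, 2, 3, 4, 5, 6, 7}
  edges := {{1, 2, 3}, {1, 2, 4}, {1, 3, 4}, {2, 3, 4}, {5, 6, 7}}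
  edges_sub := by decide
  card_eq := by decide

/-- `K_5^3`: the complete 3-graph on `{1, 2, 3, 4, 5}`. -/
def K53 : ThreeGraph where
  verts := {1, 2, 3, 4, 5}
  edges := Finset.powersetCard 3 ({1, 2, 3, 4, 5} : Finset ℕ)
  edges_sub := by decide
  card_eq := by decide

set_option maxHeartbeats 1000000 in
lemma aux_poly (g : Fin 5 → ℝ) (hg : ∀ i, 0 ≤ g i) :
    (∑ p ∈ powersetCard 2 (univ : Finset (Fin 5)), ∏ i ∈ p, g i ≤ 2 / 5 * (∑ i, g i) ^ 2) ∧
    (∑ p ∈ powersetCard 3 (univ : Finset (Fin 5)), ∏ i ∈ p, g i ≤ 2 / 25 * (∑ i, g i) ^ 3) := by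
  have h2 : powersetCard 2 (univ : Finset (Fin 5)) =
      {{0,1},{0,2},{0,3},{0,4},{1,2},{1,3},{1,4},{2,3},{2,4},{3,4}} := by decide
  have h3 : powersetCard 3 (univ : Finset (Fin 5)) =
      {{0,1,2},{0,1,3},{0,1,4},{0,2,3},{0,2,4},{0,3,4},{1,2,3},{1,2,4},{1,3,4},{2,3,4}} := by
    decide
  have e2 : ∑ p ∈ powersetCard 2 (univ : Finset (Fin 5)), ∏ i ∈ p, g i =
      g 0 * g 1 + g 0 * g 2 + g 0 * g 3 + g 0 * g 4 + g 1 * g 2 + g 1 * g 3 + g 1 * g 4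
      + g 2 * g 3 + g 2 * g 4 + g 3 * g 4 := by
    rw [h2]
    repeat rw [sum_insert (by decide)]
    rw [sum_singleton]
    repeat rw [prod_pair (by decide)]
    ring
  have e3 : ∑ p ∈ powersetCard 3 (univ : Finset (Fin 5)), ∏ i ∈ p, g i =
      g 0 * g 1 * g 2 + g 0 * g 1 * g 3 + g 0 * g 1 * g 4 + g 0 * g 2 * g 3 + g 0 * g 2 * g 4
      + g 0 * g 3 * g 4 + g 1 * g 2 * g 3 + g 1 * g 2 * g 4 + g 1 * g 3 * g 4
      + g 2 * g 3 * g 4 := by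
    rw [h3]
    repeat rw [sum_insert (by decide)]
    rw [sum_singleton]
    repeat rw [prod_insert (by decide)]
    simp only [prod_singleton]
    ring
  have key : ∀ i j k, 0 ≤ g i * (g j - g k) ^ 2 := fun i j k => mul_nonneg (hg i) (sq_nonneg _)
  have A : 0 ≤ ∑ i, ∑ j, ∑ k, g i * (g j - g k) ^ 2 :=
    sum_nonneg fun i _ => sum_nonneg fun j _ => sum_nonneg fun k _ => key i j k
  have B : 0 ≤ ∑ i, ∑ j, g i * (g i - g j) ^ 2 :=
    sum_nonneg fun i _ => sum_nonneg fun j _ => key i i j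
  have C : 0 ≤ ∑ i, ∑ j, (g i - g j) ^ 2 :=
    sum_nonneg fun i _ => sum_nonneg fun j _ => sq_nonneg _
  have D : 0 ≤ ∑ i, ∑ j, (g i) * (g i - g j) ^ 2 + ∑ i, ∑ j, (g j) * (g i - g j) ^ 2 :=
    add_nonneg B (sum_nonneg fun i _ => sum_nonneg fun j _ => key j i j)
  have F : 0 ≤ ∑ i, ∑ j, ∑ k, (if i = j ∨ i = k then 0 else g i * (g j - g k) ^ 2) :=
    sum_nonneg fun i _ => sum_nonneg fun j _ => sum_nonneg fun k _ => by
      split_ifs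
      · exact le_rfl
      · exact key i j k
  rw [e2, e3]
  simp [Fin.sum_univ_five] at A B C D F ⊢
  constructor
  · linarith [C]
  · clear e2 e3 h2 h3 key hg A B C
    linarith [D, F]

lemma aux_S (S : Finset ℕ) (hS : S.card = 5) (w : ℕ → ℝ) (hw : ∀ v ∈ S, 0 ≤ w v) :
    (∑ p ∈ powersetCard 2 S, ∏ i ∈ p, w i ≤ 2 / 5 * (∑ i ∈ S, w i) ^ 2) ∧
    (∑ p ∈ powersetCard 3 S, ∏ i ∈ p, w i ≤ 2 / 25 * (∑ i ∈ S, w i) ^ 3) := by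
  obtain ⟨φ, hφ⟩ : ∃ φ : Fin 5 ↪ ℕ, S = univ.map φ :=
    ⟨(S.orderEmbOfFin hS).toEmbedding, by simp⟩
  subst hφ
  have := aux_poly (fun i => w (φ i)) (fun i => hw _ (by simp))
  simpa [powersetCard_map, sum_map, prod_map] using this

set_option maxHeartbeats 1000000 in
lemma aux_meet (G : ThreeGraph) (hfree : G.Free K43e) (S : Finset ℕ) (hSV : S ⊆ G.verts)
    (hS : S.card = 5) (hK : ∀ e ⊆ S, e.card = 3 → e ∈ G.edges) (e : Finset ℕ)
    (he : e ∈ G.edges) : 2 ≤ (e ∩ S).card := by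
  by_contra hlt
  have hc : 4 ≤ (S \ e).card := by
    have := card_sdiff_add_card_inter S e
    rw [inter_comm] at this
    omega
  obtain ⟨T, hT, hT4⟩ := exists_subset_card_eq hc
  obtain ⟨a, T', ha, rfl, hT'⟩ := card_eq_succ.1 hT4
  obtain ⟨b, c, d, hbc, hbd, hcd, rfl⟩ := card_eq_three.1 hT'
  have heV := G.edges_sub e he
  obtain ⟨x, y, z, hxy, hxz, hyz, rfl⟩ := card_eq_three.1 (G.card_eq e he)
  have hTS : ∀ v ∈ ({a, b, c, d} : Finset ℕ), v ∈ S ∧ v ≠ x ∧ v ≠ y ∧ v ≠ z := by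
    intro v hv
    have := hT hv
    simpa using this
  simp only [mem_insert, mem_singleton, forall_eq_or_imp, forall_eq] at hTS
  simp only [mem_insert, mem_singleton, not_or] at ha
  obtain ⟨⟨aS, a1, a2, a3⟩, ⟨bS, b1, b2, b3⟩, ⟨cS, c1, c2, c3⟩, ⟨dS, d1, d2, d3⟩⟩ := hTS
  obtain ⟨hab, hac, had⟩ := ha
  have tri : ∀ p q r, p ∈ S → q ∈ S → r ∈ S → p ≠ q → p ≠ r → q ≠ r →
      ({p, q, r} : Finset ℕ) ∈ G.edges := by
    intro p q r hp hq hr h1 h2 h3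
    apply hK
    · intro v hv
      simp only [mem_insert, mem_singleton] at hv
      rcases hv with rfl | rfl | rfl <;> assumption
    · exact card_eq_three.2 ⟨p, q, r, h1, h2, h3, rfl⟩
  have hx := heV (show x ∈ ({x, y, z} : Finset ℕ) by simp)
  have hy := heV (show y ∈ ({x, y, z} : Finset ℕ) by simp)
  have hz := heV (show z ∈ ({x, y, z} : Finset ℕ) by simp)
  apply hfree
  let f : ℕ → ℕ := fun n => if n = 1 then a else if n = 2 then b else if n = 3 then c else
    if n = 4 then d else if n = 5 then x else if n = 6 then y else z
  have f1 : f 1 = a := by simp [f]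
  have f2 : f 2 = b := by simp [f]
  have f3 : f 3 = c := by simp [f]
  have f4 : f 4 = d := by simp [f]
  have f5 : f 5 = x := by simp [f]
  have f6 : f 6 = y := by simp [f]
  have f7 : f 7 = z := by simp [f]
  clear_value f
  refine ⟨f, ?_, ?_, ?_⟩
  · intro p hp q hq hpq
    simp only [K43e, coe_insert, coe_singleton, Set.mem_insert_iff, Set.mem_singleton_iff] at hp hq
    rcases hp with rfl | rfl | rfl | rfl | rfl | rfl | rfl <;>
    rcases hq with rfl | rfl | rfl | rfl | rfl | rfl | rfl <;>
    first | rfl | (simp only [f1, f2, f3, f4, f5, f6, f7] at hpq; first | (exact absurd hpq (by assumption)) | (exact absurd hpq.symm (by assumption)))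
  · intro v hv
    simp only [K43e, mem_insert, mem_singleton] at hv
    rcases hv with rfl | rfl | rfl | rfl | rfl | rfl | rfl <;>
    simp only [f1, f2, f3, f4, f5, f6, f7] <;> first | assumption | (apply hSV; assumption)
  · intro t ht
    simp only [K43e, mem_insert, mem_singleton] at ht
    rcases ht with rfl | rfl | rfl | rfl | rfl <;>
    simp only [image_insert, image_singleton, f1, f2, f3, f4, f5, f6, f7] <;>
    first | assumption | (apply tri <;> assumption)

lemma aux_main (G : ThreeGraph) (hfree : G.Free K43e) (hlag : Real.sqrt 3 / 18 < G.lag)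
    (S : Finset ℕ) (hSV : S ⊆ G.verts) (hS : S.card = 5)
    (hK : ∀ e ⊆ S, e.card = 3 → e ∈ G.edges) : False := by
  have hsq : (1.7 : ℝ) < Real.sqrt 3 := Real.lt_sqrt_of_sq_lt (by norm_num)
  have hle : G.lag ≤ 5 / 54 := by
    apply Real.sSup_le _ (by norm_num)
    rintro _ ⟨w, ⟨hw0, hw1⟩, rfl⟩
    obtain ⟨h2, h3⟩ := aux_S S hS w fun v hv => hw0 v (hSV hv)
    have hsum : ∑ v ∈ G.verts \ S, w v + ∑ v ∈ S, w v = 1 := by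
      rw [← hw1]; exact sum_sdiff hSV
    have ht0 : 0 ≤ ∑ v ∈ G.verts \ S, w v :=
      sum_nonneg fun v hv => hw0 v (mem_sdiff.1 hv).1
    have hs0 : 0 ≤ ∑ v ∈ S, w v := sum_nonneg fun v hv => hw0 v (hSV hv)
    set U := (powersetCard 2 S ×ˢ (G.verts \ S)).image (fun q => insert q.2 q.1) with hU
    have hpos : ∀ e ∈ powersetCard 3 S ∪ U, 0 ≤ ∏ v ∈ e, w v := by
      intro e he
      apply prod_nonneg
      intro v hv
      apply hw0
      rcases mem_union.1 he with he | he
      · exact hSV ((mem_powersetCard.1 he).1 hv)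
      · obtain ⟨⟨p, u⟩, hq, rfl⟩ := mem_image.1 he
        simp only [mem_product, mem_powersetCard, mem_sdiff] at hq
        rcases mem_insert.1 hv with rfl | hv
        · exact hq.2.1
        · exact hSV (hq.1.1 hv)
    have hsub : G.edges ⊆ powersetCard 3 S ∪ U := by
      intro e he
      have hm := aux_meet G hfree S hSV hS hK e he
      have hc := G.card_eq e he
      have hadd := card_sdiff_add_card_inter e S
      by_cases hes : e ⊆ S
      · exact mem_union_left _ (mem_powersetCard.2 ⟨hes, hc⟩)
      · apply mem_union_right
        have hne : (e \ S).card ≠ 0 := by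
          rw [Ne, card_eq_zero, sdiff_eq_empty_iff_subset]; exact hes
        obtain ⟨u, hu⟩ := card_eq_one.1 (show (e \ S).card = 1 by omega)
        have hu' : u ∈ e \ S := by rw [hu]; simp
        refine mem_image.2 ⟨(e ∩ S, u), ?_, ?_⟩
        · simp only [mem_product, mem_powersetCard, mem_sdiff]
          exact ⟨⟨inter_subset_right, by omega⟩, G.edges_sub e he (mem_sdiff.1 hu').1,
            (mem_sdiff.1 hu').2⟩
        · change insert u (e ∩ S) = e
          rw [insert_eq, ← hu, sdiff_union_inter]
    have hinj : Set.InjOn (fun q : Finset ℕ × ℕ => insert q.2 q.1)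
        (powersetCard 2 S ×ˢ (G.verts \ S) : Finset (Finset ℕ × ℕ)) := by
      rintro ⟨p, u⟩ hq ⟨p', u'⟩ hq' h
      simp only [coe_product, Set.mem_prod, mem_coe, mem_powersetCard, mem_sdiff] at hq hq'
      simp only at h
      have hu : u = u' := by
        have : u ∈ insert u' p' := by rw [← h]; simp
        rcases mem_insert.1 this with h | h
        · exact h
        · exact absurd (hq'.1.1 h) hq.2.2
      subst hu
      have h1 : u ∉ p := fun hh => hq.2.2 (hq.1.1 hh)
      have h2 : u ∉ p' := fun hh => hq.2.2 (hq'.1.1 hh)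
      have : p = p' := by rw [← erase_insert h1, h, erase_insert h2]
      rw [this]
    have hUs : ∑ e ∈ U, ∏ v ∈ e, w v =
        (∑ p ∈ powersetCard 2 S, ∏ i ∈ p, w i) * ∑ v ∈ G.verts \ S, w v := by
      rw [hU, sum_image hinj, sum_mul_sum, ← sum_product']
      apply sum_congr rfl
      rintro ⟨p, u⟩ hq
      simp only [mem_product, mem_powersetCard, mem_sdiff] at hq
      rw [prod_insert (fun hh => hq.2.2 (hq.1.1 hh)), mul_comm]
    have hdis : Disjoint (powersetCard 3 S) U := by
      rw [disjoint_left]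
      intro e he he'
      obtain ⟨⟨p, u⟩, hq, rfl⟩ := mem_image.1 he'
      simp only [mem_product, mem_powersetCard, mem_sdiff] at hq he
      exact hq.2.2 (he.1 (mem_insert_self _ _))
    have hb : G.lagFun w ≤ ∑ e ∈ powersetCard 3 S ∪ U, ∏ v ∈ e, w v :=
      sum_le_sum_of_subset_of_nonneg hsub fun e he _ => hpos e he
    rw [sum_union hdis, hUs] at hb
    have hm := mul_le_mul_of_nonneg_right h2 ht0
    generalize ∑ v ∈ S, w v = s at *
    generalize ∑ v ∈ G.verts \ S, w v = t at *
    obtain rfl : t = 1 - s := by linarith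
    have : 2 / 5 * s ^ 2 * (1 - s) + 2 / 25 * s ^ 3 ≤ 5 / 54 := by
      nlinarith [mul_nonneg hs0 (sq_nonneg (s - 5 / 6)), sq_nonneg (s - 5 / 6)]
    linarith
  linarith

theorem dense_K43e_free_K53_free (G : ThreeGraph) (hdense : G.LagDense)
    (hfree : G.Free K43e) (hlag : Real.sqrt 3 / 18 < G.lag) :
    G.Free K53 ∧
      ¬ ∃ S : Finset ℕ, S ⊆ G.verts ∧ S.card = 5 ∧
        ∀ e ⊆ S, e.card = 3 → e ∈ G.edges := by
  constructor
  · rintro ⟨f, hf, hv, he⟩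
    refine aux_main G hfree hlag (K53.verts.image f) ?_ ?_ ?_
    · intro x hx
      obtain ⟨v, hv', rfl⟩ := mem_image.1 hx
      exact hv v hv'
    · rw [card_image_of_injOn hf]; rfl
    · intro e hes hc
      obtain ⟨e', he', rfl⟩ := subset_image_iff.1 hes
      apply he
      rw [card_image_of_injOn (hf.mono he')] at hc
      exact mem_powersetCard.2 ⟨by exact_mod_cast he', hc⟩
  · rintro ⟨S, h1, h2, h3⟩
    exact aux_main G hfree hlag S h1 h2 h3
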